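/- Let (L,d,[-,-],(-,-)) be a quasi-cyclic DG-Lie algebra of degree 1 over a field K of characteristic 0, with a splitting L = H ⊕ d(K) ⊕ K satisfying: H^i = 0 for i < 0; H^0 is closed under the bracket; H^i and K^i are H^0-submodules under the adjoint action for all i ∈ ℤ; and H ⊥ K. Then the transferred higher brackets vanish: {⋯}_p = 0 on H^{∧p} for all p ≥ 3. Consequently the transferred minimal L∞ model of L is the graded Lie algebra H ≅ H*(L) and L is formal. -/

import Mathlib

/-!
Core definitions: differential graded Lie algebras (DGLAs) over a field `K`,
their cohomology, morphisms, quasi-isomorphisms, zigzags and formality.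

A ℤ-graded vector space is encoded as a module `carrier` together with an internal
direct sum decomposition `grading : ℤ → Submodule K carrier`.
-/

/-- A differential graded Lie algebra over `K`.  The differential `d` has degree `+1`,
the bracket `br` is graded skew-symmetric, satisfies the graded Jacobi identity and
`d` is a graded derivation with respect to it. -/
structure DGLA (K : Type) [Field K] : Type 1 where
  carrier : Type
  [acg : AddCommGroup carrier]
  [mod : Module K carrier]
  grading : ℤ → Submodule K carrier
  internal : DirectSum.IsInternal grading
  d : carrier → carrier
  d_lin : IsLinearMap K d
  d_mem : ∀ i : ℤ, ∀ x ∈ grading i, d x ∈ grading (i + 1)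
  d_sq : ∀ x, d (d x) = 0
  br : carrier → carrier → carrier
  br_lin₁ : ∀ y, IsLinearMap K fun x => br x y
  br_lin₂ : ∀ x, IsLinearMap K (br x)
  br_mem : ∀ i j : ℤ, ∀ x ∈ grading i, ∀ y ∈ grading j, br x y ∈ grading (i + j)
  skew : ∀ i j : ℤ, ∀ x ∈ grading i, ∀ y ∈ grading j,
      br x y = -((-1 : K) ^ (i * j) • br y x)
  jacobi : ∀ i j : ℤ, ∀ x ∈ grading i, ∀ y ∈ grading j, ∀ z : carrier,
      br x (br y z) = br (br x y) z + (-1 : K) ^ (i * j) • br y (br x z)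
  leibniz : ∀ i : ℤ, ∀ x ∈ grading i, ∀ y : carrier,
      d (br x y) = br (d x) y + (-1 : K) ^ i • br x (d y)

attribute [instance] DGLA.acg DGLA.mod

variable {K : Type} [Field K]

/-- The differential bundled as a linear map. -/
def DGLA.dHom (A : DGLA K) : A.carrier →ₗ[K] A.carrier := IsLinearMap.mk' A.d A.d_lin

/-- Degree `i` cocycles. -/
def DGLA.cocycles (A : DGLA K) (i : ℤ) : Submodule K A.carrier :=
  A.grading i ⊓ LinearMap.ker A.dHom

/-- Degree `i` coboundaries. -/
def DGLA.coboundaries (A : DGLA K) (i : ℤ) : Submodule K A.carrier :=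
  A.grading i ⊓ LinearMap.range A.dHom

/-- Degree `i` cohomology `H^i(L)` as a quotient vector space. -/
abbrev DGLA.cohomology (A : DGLA K) (i : ℤ) :=
  A.cocycles i ⧸ ((A.coboundaries i).comap (A.cocycles i).subtype)

/-- A morphism of DGLAs. -/
structure DGLAHom (A B : DGLA K) where
  toFun : A.carrier → B.carrier
  lin : IsLinearMap K toFun
  map_grading : ∀ i : ℤ, ∀ x ∈ A.grading i, toFun x ∈ B.grading i
  map_d : ∀ x, toFun (A.d x) = B.d (toFun x)
  map_br : ∀ x y, toFun (A.br x y) = B.br (toFun x) (toFun y)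

/-- `f` is a quasi-isomorphism: it induces bijections on cohomology in every degree. -/
def DGLAHom.IsQuasiIso {A B : DGLA K} (f : DGLAHom A B) : Prop :=
  ∀ i : ℤ,
    (∀ x ∈ A.cocycles i, f.toFun x ∈ B.coboundaries i → x ∈ A.coboundaries i) ∧
    (∀ y ∈ B.cocycles i, ∃ x ∈ A.cocycles i, f.toFun x - y ∈ B.coboundaries i)

/-- There exists a quasi-isomorphism `A → B`. -/
def QIso (A B : DGLA K) : Prop := ∃ f : DGLAHom A B, f.IsQuasiIso

/-- Two DGLAs are connected by a zigzag of quasi-isomorphisms. -/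
inductive ZigzagQIso : DGLA K → DGLA K → Prop
  | of {A B : DGLA K} : QIso A B → ZigzagQIso A B
  | refl (A : DGLA K) : ZigzagQIso A A
  | symm {A B : DGLA K} : ZigzagQIso A B → ZigzagQIso B A
  | trans {A B C : DGLA K} : ZigzagQIso A B → ZigzagQIso B C → ZigzagQIso A C

/-- A DGLA is formal if it is connected by a zigzag of quasi-isomorphisms to a DGLA
with zero differential.  (This is equivalent to being connected by a zigzag of
quasi-isomorphisms to its cohomology `H^*(L)` endowed with the zero differential and
the induced bracket: any zero-differential DGLA quasi-isomorphic to `L` is isomorphic,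
as a graded Lie algebra, to `H^*(L)` with the induced bracket.) -/
def DGLA.IsFormal (A : DGLA K) : Prop :=
  ∃ M : DGLA K, (∀ x, M.d x = 0) ∧ ZigzagQIso A M

/-- A quasi-cyclic DGLA of degree `n`: a DGLA with finite dimensional cohomology
equipped with a graded symmetric bilinear form of degree `-n`, compatible with `d`
and cyclic with respect to the bracket, whose induced pairing on cohomology is
non-degenerate. -/
structure QCyclicDGLA (K : Type) [Field K] (n : ℤ) extends DGLA K where
  form : carrier → carrier → K
  form_lin₁ : ∀ y, IsLinearMap K fun x => form x y
  form_lin₂ : ∀ x, IsLinearMap K (form x)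
  findim : ∀ i : ℤ, FiniteDimensional K (toDGLA.cohomology i)
  form_degree : ∀ i j : ℤ, i + j ≠ n → ∀ x ∈ grading i, ∀ y ∈ grading j, form x y = 0
  form_symm : ∀ i j : ℤ, ∀ x ∈ grading i, ∀ y ∈ grading j,
      form x y = (-1 : K) ^ (i * j) * form y x
  form_d : ∀ i : ℤ, ∀ x ∈ grading i, ∀ y,
      form (d x) y = (-1 : K) ^ (i + 1) * form x (d y)
  form_cyclic : ∀ x y z, form (br x y) z = form x (br y z)
  nondeg : ∀ i : ℤ, ∀ x ∈ toDGLA.cocycles i,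
      (∀ y ∈ toDGLA.cocycles (n - i), form x y = 0) → x ∈ toDGLA.coboundaries i

/-- A splitting `L = H ⊕ d(K) ⊕ K` of the complex `(L, d)` into graded subspaces:
`d` vanishes on `H`, is injective on `K = Kc`, and in every degree `i` one has the
internal direct sum `L^i = H^i ⊕ d(K^{i-1}) ⊕ K^i`. -/
structure GradedSplitting (A : DGLA K) where
  H : ℤ → Submodule K A.carrier
  Kc : ℤ → Submodule K A.carrier
  H_le : ∀ i, H i ≤ A.grading i
  Kc_le : ∀ i, Kc i ≤ A.grading i
  d_H : ∀ i, ∀ x ∈ H i, A.d x = 0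
  d_Kc_inj : ∀ i, ∀ x ∈ Kc i, A.d x = 0 → x = 0
  decomp : ∀ i, H i ⊔ ((Kc (i - 1)).map A.dHom ⊔ Kc i) = A.grading i
  disj₁ : ∀ i, Disjoint (H i) ((Kc (i - 1)).map A.dHom ⊔ Kc i)
  disj₂ : ∀ i, Disjoint ((Kc (i - 1)).map A.dHom) (Kc i)

/-- The contraction data `(π, h)` determined by a splitting `L = H ⊕ d(K) ⊕ K`:
`pr` is the projection onto `H`, and `h` the degree `-1` homotopy given by projecting
onto `d(K)`, applying `-d⁻¹` and including `K` into `L`.  The listed identities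
determine `pr` and `h` uniquely. -/
structure ContractionData (A : DGLA K) (S : GradedSplitting A) where
  pr : A.carrier → A.carrier
  h : A.carrier → A.carrier
  pr_lin : IsLinearMap K pr
  h_lin : IsLinearMap K h
  pr_H : ∀ i : ℤ, ∀ x ∈ S.H i, pr x = x
  pr_dK : ∀ i : ℤ, ∀ x ∈ S.Kc i, pr (A.d x) = 0
  pr_K : ∀ i : ℤ, ∀ x ∈ S.Kc i, pr x = 0
  h_H : ∀ i : ℤ, ∀ x ∈ S.H i, h x = 0
  h_dK : ∀ i : ℤ, ∀ x ∈ S.Kc i, h (A.d x) = -x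
  h_K : ∀ i : ℤ, ∀ x ∈ S.Kc i, h x = 0
/-!  Homotopy transfer: Koszul signs, shuffles, and the recursively defined
Taylor coefficients `ι_p` and transferred brackets `{⋯}_p`. -/

/-- `(-1)^m` in `K` for an integer `m`. -/
def negOnePowK (K : Type) [Field K] (m : ℤ) : K := (-1 : K) ^ m.natAbs

/-- The antisymmetric Koszul sign `χ(σ)` of a permutation `σ` acting on homogeneous
elements of degrees `dg 0, …, dg (P-1)`: a product over the inversions of `σ` of
`-(-1)^{|ξ_a||ξ_b|}`. -/
def koszulSign (K : Type) [Field K] {P : ℕ} (dg : Fin P → ℤ) (σ : Equiv.Perm (Fin P)) : K :=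
  ∏ q ∈ Finset.univ.filter
      (fun q : Fin P × Fin P => q.1 < q.2 ∧ σ q.2 < σ q.1),
    -negOnePowK K (dg (σ q.1) * dg (σ q.2))

/-- The sign `(-1)^{α(σ)}` with `α(σ) = (1-P+k)(k + Σ_{i<k} |ξ_{σ(i)}|)`. -/
def alphaSign (K : Type) [Field K] {P : ℕ} (k : ℕ) (dg : Fin P → ℤ) (σ : Equiv.Perm (Fin P)) : K :=
  negOnePowK K ((1 - (P : ℤ) + (k : ℤ)) *
    ((k : ℤ) + ∑ i ∈ Finset.univ.filter (fun i : Fin P => (i : ℕ) < k), dg (σ i)))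

/-- The set of `(k, P-k)`-shuffles in the symmetric group of `Fin P`. -/
def shuffles (P k : ℕ) : Finset (Equiv.Perm (Fin P)) :=
  Finset.univ.filter fun σ =>
    ∀ i j : Fin P, i < j → ((j : ℕ) < k ∨ k ≤ (i : ℕ)) → σ i < σ j

/-- Auxiliary total indexing function `ℕ → Fin (p+2)` (reduction mod `p+2`);
on the ranges actually used in the transfer formulas it is the obvious inclusion. -/
def finIdx (p : ℕ) (m : ℕ) : Fin (p + 2) := ⟨m % (p + 2), Nat.mod_lt m (by omega)⟩

/-- The first `j` entries of a `p`-tuple. -/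
def tupleTake {M : Type} (p j : ℕ) (h : j ≤ p) (v : Fin p → M) : Fin j → M :=
  fun i => v (Fin.castLE h i)

/-- The last `p - j` entries of a `p`-tuple. -/
def tupleDrop {M : Type} (p j : ℕ) (h : j ≤ p) (v : Fin p → M) : Fin (p - j) → M :=
  fun i => v ⟨j + (i : ℕ), by have := i.isLt; omega⟩

variable {K : Type} [Field K]

/-- The homotopy transfer family associated to a splitting with contraction data
`(pr, h)`: `ι p` are the Taylor coefficients of the induced `L∞` quasi-isomorphism
`H → L` and `bh p` the transferred higher brackets on `H ≅ H^*(L)`, characterized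
(on tuples of homogeneous elements of `H`) by `ι 1 = inclusion` together with the
standard recursive shuffle formulas. -/
structure IsTransfer (A : DGLA K) (S : GradedSplitting A) (C : ContractionData A S)
    (ι : (p : ℕ) → (Fin p → A.carrier) → A.carrier)
    (bh : (p : ℕ) → (Fin p → A.carrier) → A.carrier) : Prop where
  iota_one : ∀ v : Fin 1 → A.carrier, ι 1 v = v 0
  iota_rec : ∀ (p : ℕ) (dg : Fin (p + 2) → ℤ) (v : Fin (p + 2) → A.carrier),
      (∀ i, v i ∈ S.H (dg i)) →
      ι (p + 2) v = (2 : K)⁻¹ •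
        ∑ k ∈ Finset.Ioo 0 (p + 2), ∑ σ ∈ shuffles (p + 2) k,
          (koszulSign K dg σ * alphaSign K k dg σ) •
            C.h (A.br (ι k fun i => v (σ (finIdx p (i : ℕ))))
                 (ι (p + 2 - k) fun i => v (σ (finIdx p (k + (i : ℕ))))))
  bracket_rec : ∀ (p : ℕ) (dg : Fin (p + 2) → ℤ) (v : Fin (p + 2) → A.carrier),
      (∀ i, v i ∈ S.H (dg i)) →
      bh (p + 2) v = (2 : K)⁻¹ •
        ∑ k ∈ Finset.Ioo 0 (p + 2), ∑ σ ∈ shuffles (p + 2) k,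
          (koszulSign K dg σ * alphaSign K k dg σ) •
            C.pr (A.br (ι k fun i => v (σ (finIdx p (i : ℕ))))
                  (ι (p + 2 - k) fun i => v (σ (finIdx p (k + (i : ℕ))))))

/-! ### Sub- and quotient DGLAs cut out by a linear endomorphism -/

/-- The bracket bundled as a bilinear map. -/
def DGLA.brHom (A : DGLA K) : A.carrier →ₗ[K] A.carrier →ₗ[K] A.carrier :=
  LinearMap.mk₂ K A.br (fun x x' y => (A.br_lin₁ y).map_add x x')
    (fun c x y => (A.br_lin₁ y).map_smul c x)
    (fun x y y' => (A.br_lin₂ x).map_add y y') (fun c x y => (A.br_lin₂ x).map_smul c y)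

@[simp] lemma DGLA.brHom_apply (A : DGLA K) (x y : A.carrier) : A.brHom x y = A.br x y := rfl

@[simp] lemma DGLA.dHom_apply (A : DGLA K) (x : A.carrier) : A.dHom x = A.d x := rfl

lemma DGLA.br_zero (A : DGLA K) (x : A.carrier) : A.br x 0 = 0 := (A.brHom x).map_zero

lemma DGLA.zero_br (A : DGLA K) (x : A.carrier) : A.br 0 x = 0 := (A.brHom.flip x).map_zero

lemma DGLA.br_add (A : DGLA K) (x y z : A.carrier) : A.br x (y + z) = A.br x y + A.br x z :=
  (A.br_lin₂ x).map_add y z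

lemma DGLA.d_zero (A : DGLA K) : A.d 0 = 0 := A.dHom.map_zero

lemma DGLA.d_add (A : DGLA K) (x y : A.carrier) : A.d (x + y) = A.d x + A.d y :=
  A.d_lin.map_add x y

/-- Two linear maps agreeing on each member of a family of submodules agree on its supremum. -/
lemma LinearMap.eq_of_mem_iSup {M N : Type} [AddCommGroup M] [Module K M] [AddCommGroup N]
    [Module K N] (V : ℤ → Submodule K M) (f g : M →ₗ[K] N)
    (h : ∀ i, ∀ x ∈ V i, f x = g x) {x : M} (hx : x ∈ ⨆ i, V i) : f x = g x := by
  have : (⨆ i, V i) ≤ LinearMap.eqLocus f g := iSup_le fun i y hy => h i y hy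
  exact this hx

/-- Submodules of the pieces of a grading form a grading of their supremum. -/
lemma DirectSum.IsInternal.comap_subtype_iSup {M : Type} [AddCommGroup M] [Module K M]
    {G V : ℤ → Submodule K M} (hG : DirectSum.IsInternal G) (hV : ∀ i, V i ≤ G i) :
    DirectSum.IsInternal fun i => (V i).comap (⨆ i, V i).subtype := by
  have hind : iSupIndep V := hG.submodule_iSupIndep.mono hV
  apply DirectSum.isInternal_submodule_of_iSupIndep_of_iSup_eq_top
  · intro i
    rw [Submodule.disjoint_def]
    intro x hx hx'
    have h1 : (x : M) ∈ ⨆ j, ⨆ (_ : j ≠ i), V j := by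
      have := Submodule.mem_map_of_mem (f := (⨆ i, V i).subtype) hx'
      simp only [Submodule.map_iSup] at this
      exact iSup₂_mono (fun j _ => Submodule.map_comap_le _ (V j)) this
    exact Subtype.ext ((Submodule.disjoint_def.1 (hind i)) x hx h1)
  · apply Submodule.map_injective_of_injective (⨆ i, V i).injective_subtype
    rw [Submodule.map_iSup, Submodule.map_top, Submodule.range_subtype]
    refine iSup_congr fun i => ?_
    rw [Submodule.map_comap_subtype]
    exact inf_eq_right.2 (le_iSup V i)

/-- A graded subspace `V` of a DGLA `A`, with bracket `e [x, y]` for a linear map `e` which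
is compatible with the brackets and the differential, is a DGLA. -/
def DGLA.retract (A : DGLA K) (V : ℤ → Submodule K A.carrier) (e : A.carrier →ₗ[K] A.carrier)
    (hV : ∀ i, V i ≤ A.grading i)
    (hd : ∀ i, ∀ x ∈ V i, A.d x ∈ V (i + 1))
    (hbr : ∀ i j, ∀ x ∈ V i, ∀ y ∈ V j, e (A.br x y) ∈ V (i + j))
    (hL : ∀ i j, ∀ x ∈ V i, ∀ y ∈ V j, A.d (e (A.br x y)) = e (A.d (A.br x y)))
    (hJ : ∀ i j k, ∀ x ∈ V i, ∀ y ∈ V j, ∀ z ∈ V k,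
      e (A.br x (e (A.br y z))) = e (A.br x (A.br y z))) : DGLA K :=
  have hdW : ∀ x ∈ ⨆ i, V i, A.dHom x ∈ ⨆ i, V i := fun x hx => by
    have : (⨆ i, V i) ≤ (⨆ i, V i).comap A.dHom :=
      iSup_le fun i y hy => Submodule.mem_iSup_of_mem (i + 1) (hd i y hy)
    exact this hx
  have hbrW : ∀ x ∈ ⨆ i, V i, ∀ y ∈ ⨆ i, V i, e (A.br x y) ∈ ⨆ i, V i := fun x hx y hy => by
    have h2 : ∀ j, ∀ y ∈ V j, ∀ x ∈ ⨆ i, V i, e (A.br x y) ∈ ⨆ i, V i := fun j y hy x hx => by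
      have : (⨆ i, V i) ≤ (⨆ i, V i).comap (e ∘ₗ A.brHom.flip y) :=
        iSup_le fun i x hx => Submodule.mem_iSup_of_mem (i + j) (hbr i j x hx y hy)
      exact this hx
    have : (⨆ i, V i) ≤ (⨆ i, V i).comap (e ∘ₗ A.brHom x) :=
      iSup_le fun j y hy => h2 j y hy x hx
    exact this hy
  { carrier := ↥(⨆ i, V i)
    grading := fun i => (V i).comap (⨆ i, V i).subtype
    internal := A.internal.comap_subtype_iSup hV
    d := fun x => ⟨A.dHom x, hdW x x.2⟩
    d_lin := ⟨fun x y => Subtype.ext (A.d_lin.map_add x y),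
      fun c x => Subtype.ext (A.d_lin.map_smul c x)⟩
    d_mem := fun i x hx => hd i x hx
    d_sq := fun x => Subtype.ext (A.d_sq x)
    br := fun x y => ⟨e (A.brHom x y), hbrW x x.2 y y.2⟩
    br_lin₁ := fun y => ⟨fun x x' => Subtype.ext (by
      simp only [Submodule.coe_add, map_add, LinearMap.add_apply]), fun c x => Subtype.ext (by
      simp only [Submodule.coe_smul, map_smul, LinearMap.smul_apply])⟩
    br_lin₂ := fun y => ⟨fun x x' => Subtype.ext (by
      simp only [Submodule.coe_add, map_add]), fun c x => Subtype.ext (by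
      simp only [Submodule.coe_smul, map_smul])⟩
    br_mem := fun i j x hx y hy => hbr i j x hx y hy
    skew := fun i j x hx y hy => Subtype.ext (by
      have := A.skew i j x (hV i hx) y (hV j hy)
      simp [this])
    jacobi := fun i j x hx y hy z => Subtype.ext (by
      have key := LinearMap.eq_of_mem_iSup V
        (e ∘ₗ A.brHom x ∘ₗ e ∘ₗ A.brHom y)
        (e ∘ₗ A.brHom (e (A.br x y)) + (-1 : K) ^ (i * j) • e ∘ₗ A.brHom y ∘ₗ e ∘ₗ A.brHom x)
        (fun k z hz => ?_) z.2
      · simpa using key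
      · have hx : (x : A.carrier) ∈ V i := hx
        have hy : (y : A.carrier) ∈ V j := hy
        have hxy := hbr i j x hx y hy
        have h3 : e (A.br (e (A.br x y)) z) = e (A.br (A.br x y) z) := by
          rw [A.skew _ _ _ (hV _ hxy) _ (hV _ hz),
            A.skew _ _ _ (A.br_mem _ _ _ (hV _ hx) _ (hV _ hy)) _ (hV _ hz)]
          simp only [map_neg, map_smul]
          rw [hJ k i j z hz x hx y hy]
        have h4 := A.jacobi i j x (hV _ hx) y (hV _ hy) z
        simp only [LinearMap.comp_apply, LinearMap.add_apply, LinearMap.smul_apply,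
          DGLA.brHom_apply]
        rw [hJ i j k x hx y hy z hz, hJ j i k y hy x hx z hz, h3, h4]
        simp)
    leibniz := fun i x hx y => Subtype.ext (by
      have key := LinearMap.eq_of_mem_iSup V
        (A.dHom ∘ₗ e ∘ₗ A.brHom x)
        (e ∘ₗ A.brHom (A.d x) + (-1 : K) ^ i • e ∘ₗ A.brHom x ∘ₗ A.dHom)
        (fun j y hy => ?_) y.2
      · simpa using key
      · simp only [LinearMap.comp_apply, LinearMap.add_apply, LinearMap.smul_apply,
          DGLA.brHom_apply, DGLA.dHom_apply]
        rw [hL i j x hx y hy, A.leibniz i x (hV _ hx)]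
        simp) }

/-! ### Splittings and their contraction data -/

namespace GradedSplitting

variable {A : DGLA K} (S : GradedSplitting A)

lemma exists_decomp (i : ℤ) {x : A.carrier} (hx : x ∈ A.grading i) :
    ∃ a ∈ S.H i, ∃ k ∈ S.Kc (i - 1), ∃ l ∈ S.Kc i, x = a + A.d k + l := by
  rw [← S.decomp i] at hx
  obtain ⟨a, ha, b, hb, rfl⟩ := Submodule.mem_sup.1 hx
  obtain ⟨c, ⟨k, hk, rfl⟩, l, hl, rfl⟩ := Submodule.mem_sup.1 hb
  exact ⟨a, ha, k, hk, l, hl, by simp [add_assoc]⟩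

lemma exists_decomp_of_cocycle (i : ℤ) {x : A.carrier} (hx : x ∈ A.grading i)
    (hdx : A.d x = 0) : ∃ a ∈ S.H i, ∃ k ∈ S.Kc (i - 1), x = a + A.d k := by
  obtain ⟨a, ha, k, hk, l, hl, rfl⟩ := S.exists_decomp i hx
  have : l = 0 := S.d_Kc_inj i l hl (by
    simpa [A.d_add, S.d_H i a ha, A.d_sq] using hdx)
  exact ⟨a, ha, k, hk, by simp [this]⟩

end GradedSplitting

namespace ContractionData

variable {A : DGLA K} {S : GradedSplitting A} (C : ContractionData A S)

/-- The projection onto `H` bundled as a linear map. -/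
def prHom : A.carrier →ₗ[K] A.carrier := IsLinearMap.mk' C.pr C.pr_lin

@[simp] lemma prHom_apply (x : A.carrier) : C.prHom x = C.pr x := rfl

lemma pr_decomp {i : ℤ} {a k l : A.carrier} (ha : a ∈ S.H i) (hk : k ∈ S.Kc (i - 1))
    (hl : l ∈ S.Kc i) : C.pr (a + A.d k + l) = a := by
  rw [C.pr_lin.map_add, C.pr_lin.map_add, C.pr_H i a ha, C.pr_dK _ k hk, C.pr_K i l hl]
  simp

lemma pr_mem {i : ℤ} {x : A.carrier} (hx : x ∈ A.grading i) : C.pr x ∈ S.H i := by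
  obtain ⟨a, ha, k, hk, l, hl, rfl⟩ := S.exists_decomp i hx
  rwa [C.pr_decomp ha hk hl]

lemma h_mem {i : ℤ} {x : A.carrier} (hx : x ∈ A.grading i) : C.h x ∈ S.Kc (i - 1) := by
  obtain ⟨a, ha, k, hk, l, hl, rfl⟩ := S.exists_decomp i hx
  rw [C.h_lin.map_add, C.h_lin.map_add, C.h_H i a ha, C.h_dK _ k hk, C.h_K i l hl]
  simpa using hk

lemma pr_d (x : A.carrier) : C.pr (A.d x) = 0 := by
  refine LinearMap.eq_of_mem_iSup A.grading (C.prHom ∘ₗ A.dHom) 0 (fun i y hy => ?_)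
    (A.internal.submodule_iSup_eq_top ▸ Submodule.mem_top : x ∈ ⨆ i, A.grading i)
  obtain ⟨a, ha, k, hk, l, hl, rfl⟩ := S.exists_decomp i hy
  simp [A.d_add, S.d_H i a ha, A.d_sq, C.pr_dK i l hl]

lemma exists_eq_d {i : ℤ} {x : A.carrier} (hx : x ∈ A.grading i) (hdx : A.d x = 0)
    (hpr : C.pr x = 0) : ∃ k ∈ S.Kc (i - 1), x = A.d k := by
  obtain ⟨a, ha, k, hk, rfl⟩ := S.exists_decomp_of_cocycle i hx hdx
  have := C.pr_decomp ha hk (S.Kc i).zero_mem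
  rw [add_zero, hpr] at this
  exact ⟨k, hk, by simp [← this]⟩

/-- If `g ∈ H⁰` acts on the pieces of the splitting, then its action commutes with `pr`. -/
lemma pr_br (h3H : ∀ i : ℤ, ∀ g ∈ S.H 0, ∀ x ∈ S.H i, A.br g x ∈ S.H i)
    (h3K : ∀ i : ℤ, ∀ g ∈ S.H 0, ∀ x ∈ S.Kc i, A.br g x ∈ S.Kc i) {i : ℤ} {g x : A.carrier}
    (hg : g ∈ S.H 0) (hx : x ∈ A.grading i) : C.pr (A.br g x) = A.br g (C.pr x) := by
  obtain ⟨a, ha, k, hk, l, hl, rfl⟩ := S.exists_decomp i hx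
  have h1 : A.br g (A.d k) = A.d (A.br g k) := by
    rw [A.leibniz 0 g (S.H_le 0 hg), S.d_H 0 g hg, A.zero_br]
    simp
  rw [C.pr_decomp ha hk hl, A.br_add, A.br_add, h1,
    C.pr_decomp (h3H _ _ hg _ ha) (h3K _ _ hg _ hk) (h3K _ _ hg _ hl)]

end ContractionData

lemma DGLA.br_comm_of_degree_zero (A : DGLA K) {i : ℤ} {g x : A.carrier}
    (hg : g ∈ A.grading 0) (hx : x ∈ A.grading i) : A.br x g = -A.br g x := by
  rw [A.skew i 0 x hx g hg]
  simp

/-- In a quasi-cyclic DGLA of degree `1` whose cohomology vanishes in negative degrees, the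
cohomology is concentrated in degrees `0` and `1`. -/
lemma GradedSplitting.H_eq_bot_of_two_le (A : QCyclicDGLA K 1) (S : GradedSplitting A.toDGLA)
    (C : ContractionData A.toDGLA S) (h1 : ∀ i : ℤ, i < 0 → S.H i = ⊥) (i : ℤ) (hi : 2 ≤ i) :
    S.H i = ⊥ := by
  rw [eq_bot_iff]
  intro x hx
  have hxc : x ∈ A.toDGLA.cocycles i := ⟨S.H_le i hx, S.d_H i x hx⟩
  obtain ⟨-, w, hw⟩ := A.nondeg i x hxc (fun y hy => by
    obtain ⟨a, ha, k, hk, rfl⟩ := S.exists_decomp_of_cocycle _ hy.1 hy.2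
    rw [h1 _ (by omega), Submodule.mem_bot] at ha
    subst ha
    have h := A.form_d i x (S.H_le i hx) k
    rw [S.d_H i x hx, (A.form_lin₁ k).map_zero] at h
    rw [zero_add]
    exact (mul_eq_zero.1 h.symm).resolve_left (zpow_ne_zero _ (by simp)))
  rw [Submodule.mem_bot, ← C.pr_H i x hx, ← hw]
  exact C.pr_d w

/-! ### Formality -/

section Formality

variable {A : DGLA K} {S : GradedSplitting A}

/-- The graded subspace `H⁰ ⊕ (H¹ ⊕ K¹) ⊕ L^{≥ 2}`. -/
def GradedSplitting.upper (S : GradedSplitting A) (i : ℤ) : Submodule K A.carrier :=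
  if i < 1 then S.H i else if i = 1 then S.H 1 ⊔ S.Kc 1 else A.grading i

lemma GradedSplitting.upper_of_lt {i : ℤ} (hi : i < 1) : S.upper i = S.H i := if_pos hi

lemma GradedSplitting.upper_one : S.upper 1 = S.H 1 ⊔ S.Kc 1 := by simp [upper]

lemma GradedSplitting.upper_of_two_le {i : ℤ} (hi : 2 ≤ i) : S.upper i = A.grading i := by
  rw [upper, if_neg (by omega), if_neg (by omega)]

lemma GradedSplitting.upper_le (i : ℤ) : S.upper i ≤ A.grading i := by
  rcases (by omega : i < 1 ∨ i = 1 ∨ 2 ≤ i) with h | rfl | h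
  · exact (upper_of_lt h).trans_le (S.H_le i)
  · exact upper_one.trans_le (sup_le (S.H_le 1) (S.Kc_le 1))
  · exact (upper_of_two_le h).le

lemma GradedSplitting.H_le_upper (i : ℤ) : S.H i ≤ S.upper i := by
  rcases (by omega : i < 1 ∨ i = 1 ∨ 2 ≤ i) with h | rfl | h
  · exact (upper_of_lt h).ge
  · exact le_sup_left.trans upper_one.ge
  · exact (S.H_le i).trans (upper_of_two_le h).ge

lemma GradedSplitting.Kc_le_upper {i : ℤ} (hi : 1 ≤ i) : S.Kc i ≤ S.upper i := by
  rcases (by omega : i = 1 ∨ 2 ≤ i) with rfl | h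
  · exact le_sup_right.trans upper_one.ge
  · exact (S.Kc_le i).trans (upper_of_two_le h).ge

lemma GradedSplitting.br_mem_upper
    (h3H : ∀ i : ℤ, ∀ g ∈ S.H 0, ∀ x ∈ S.H i, A.br g x ∈ S.H i)
    (h3K : ∀ i : ℤ, ∀ g ∈ S.H 0, ∀ x ∈ S.Kc i, A.br g x ∈ S.Kc i) {g : A.carrier}
    (hg : g ∈ S.H 0) {i : ℤ} {x : A.carrier}
    (hx : x ∈ S.upper i) : A.br g x ∈ S.upper i := by
  rcases (by omega : i < 1 ∨ i = 1 ∨ 2 ≤ i) with h | rfl | h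
  · rw [upper_of_lt h] at hx ⊢
    exact h3H i g hg x hx
  · rw [upper_one] at hx ⊢
    obtain ⟨a, ha, k, hk, rfl⟩ := Submodule.mem_sup.1 hx
    rw [A.br_add]
    exact Submodule.add_mem_sup (h3H 1 g hg a ha) (h3K 1 g hg k hk)
  · rw [upper_of_two_le h] at hx ⊢
    simpa using A.br_mem 0 i g (S.H_le 0 hg) x hx

/-- A DGLA with a splitting whose cohomology lies in degrees `0` and `1`, such that `H⁰` acts
on the pieces of the splitting, is formal. -/
lemma ContractionData.isFormal (C : ContractionData A S)
    (h1 : ∀ i : ℤ, i < 0 → S.H i = ⊥) (h4 : ∀ i : ℤ, 2 ≤ i → S.H i = ⊥)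
    (h3H : ∀ i : ℤ, ∀ g ∈ S.H 0, ∀ x ∈ S.H i, A.br g x ∈ S.H i)
    (h3K : ∀ i : ℤ, ∀ g ∈ S.H 0, ∀ x ∈ S.Kc i, A.br g x ∈ S.Kc i) : A.IsFormal := by
  have pr_zero : ∀ i, 2 ≤ i → ∀ x ∈ A.grading i, C.pr x = 0 := fun i hi x hx => by
    simpa [h4 i hi] using C.pr_mem hx
  have eq_zero : ∀ i, i < 0 → ∀ x ∈ S.upper i, x = 0 := fun i hi x hx => by
    rw [GradedSplitting.upper_of_lt (by omega), h1 i hi] at hx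
    simpa using hx
  -- the sub-DGLA `N`
  have hdN : ∀ i, ∀ x ∈ S.upper i, A.d x ∈ S.upper (i + 1) := fun i x hx => by
    rcases lt_or_ge i 1 with h | h
    · rw [GradedSplitting.upper_of_lt h] at hx
      rw [S.d_H i x hx]
      exact Submodule.zero_mem _
    · rw [GradedSplitting.upper_of_two_le (by omega)]
      exact A.d_mem i x (S.upper_le i hx)
  have hbrN : ∀ i j, ∀ x ∈ S.upper i, ∀ y ∈ S.upper j,
      A.br x y ∈ S.upper (i + j) := fun i j x hx y hy => by
    rcases lt_or_ge i 0 with hi | hi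
    · rw [eq_zero i hi x hx, A.zero_br]
      exact Submodule.zero_mem _
    rcases lt_or_ge j 0 with hj | hj
    · rw [eq_zero j hj y hy, A.br_zero]
      exact Submodule.zero_mem _
    rcases eq_or_lt_of_le hi with rfl | hi
    · rw [GradedSplitting.upper_of_lt (by omega)] at hx
      simpa using S.br_mem_upper h3H h3K hx hy
    rcases eq_or_lt_of_le hj with rfl | hj
    · rw [GradedSplitting.upper_of_lt (by omega)] at hy
      rw [A.br_comm_of_degree_zero (S.H_le 0 hy) (S.upper_le i hx)]
      simpa using S.br_mem_upper h3H h3K hy hx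
    rw [GradedSplitting.upper_of_two_le (by omega)]
    exact A.br_mem i j x (S.upper_le i hx) y (S.upper_le j hy)
  let N : DGLA K := A.retract S.upper LinearMap.id S.upper_le hdN hbrN
    (fun _ _ _ _ _ _ => rfl) (fun _ _ _ _ _ _ _ _ _ => rfl)
  -- the quotient DGLA `M`
  have hprN : ∀ i j, ∀ x ∈ S.upper i, ∀ y ∈ S.upper j,
      C.pr (A.br x y) = C.pr (A.br (C.pr x) (C.pr y)) := fun i j x hx y hy => by
    have hx' := S.upper_le i hx
    have hy' := S.upper_le j hy
    rcases le_or_gt 2 (i + j) with h | h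
    · rw [pr_zero _ h _ (A.br_mem i j _ hx' _ hy'), pr_zero _ h _ (A.br_mem i j _
        (S.H_le i (C.pr_mem hx')) _ (S.H_le j (C.pr_mem hy')))]
    rcases lt_or_ge i 0 with hi | hi
    · rw [eq_zero i hi x hx, C.pr_lin.map_zero, A.zero_br, A.zero_br]
    rcases lt_or_ge j 0 with hj | hj
    · rw [eq_zero j hj y hy, C.pr_lin.map_zero, A.br_zero, A.br_zero]
    rcases eq_or_lt_of_le hi with rfl | hi
    · rw [GradedSplitting.upper_of_lt (by omega)] at hx
      rw [C.pr_H 0 x hx, C.pr_br h3H h3K hx hy',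
        C.pr_H j _ (h3H j x hx _ (C.pr_mem hy'))]
    · obtain rfl : j = 0 := by omega
      rw [GradedSplitting.upper_of_lt (by omega)] at hy
      rw [C.pr_H 0 y hy, A.br_comm_of_degree_zero (S.H_le 0 hy) hx',
        A.br_comm_of_degree_zero (S.H_le 0 hy) (S.H_le i (C.pr_mem hx')), C.pr_lin.map_neg,
        C.pr_lin.map_neg, C.pr_br h3H h3K hy hx', C.pr_H i _ (h3H i y hy _ (C.pr_mem hx'))]
  have hdM : ∀ i, ∀ x ∈ S.H i, A.d x ∈ S.H (i + 1) := fun i x hx => by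
    rw [S.d_H i x hx]
    exact Submodule.zero_mem _
  have hbrM : ∀ i j, ∀ x ∈ S.H i, ∀ y ∈ S.H j,
      C.prHom (A.br x y) ∈ S.H (i + j) := fun i j x hx y hy =>
    C.pr_mem (A.br_mem i j x (S.H_le i hx) y (S.H_le j hy))
  have hLM : ∀ i j, ∀ x ∈ S.H i, ∀ y ∈ S.H j,
      A.d (C.prHom (A.br x y)) = C.prHom (A.d (A.br x y)) := fun i j x hx y hy => by
    rw [S.d_H _ _ (hbrM i j x hx y hy), prHom_apply, C.pr_d]
  have hJM : ∀ i j k, ∀ x ∈ S.H i, ∀ y ∈ S.H j, ∀ z ∈ S.H k,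
      C.prHom (A.br x (C.prHom (A.br y z))) = C.prHom (A.br x (A.br y z)) :=
    fun i j k x hx y hy z hz => by
      simp only [prHom_apply]
      have hN := hbrN j k y (S.H_le_upper j hy) z (S.H_le_upper k hz)
      rw [hprN i (j + k) x (S.H_le_upper i hx) _ hN, C.pr_H i x hx]
  let M : DGLA K := A.retract S.H C.prHom S.H_le hdM hbrM hLM hJM
  have hM : ∀ x, M.d x = 0 := fun x => Subtype.ext
    (LinearMap.eq_of_mem_iSup S.H A.dHom 0 (fun i y hy => S.d_H i y hy) x.2)
  let f : DGLAHom N A :=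
    { toFun := fun x => (x : ↥(⨆ i, S.upper i)).1
      lin := ⟨fun _ _ => rfl, fun _ _ => rfl⟩
      map_grading := fun i x hx => S.upper_le i hx
      map_d := fun _ => rfl
      map_br := fun _ _ => rfl }
  have hW : ∀ x ∈ ⨆ i, S.upper i, C.pr x ∈ ⨆ i, S.H i := fun x hx => by
    have : (⨆ i, S.upper i) ≤ (⨆ i, S.H i).comap C.prHom := iSup_le fun i y hy =>
      Submodule.mem_iSup_of_mem i (C.pr_mem (S.upper_le i hy))
    exact this hx
  have hbr' : ∀ x ∈ ⨆ i, S.upper i, ∀ y ∈ ⨆ i, S.upper i,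
      C.pr (A.br x y) = C.pr (A.br (C.pr x) (C.pr y)) := fun x hx y hy =>
    LinearMap.eq_of_mem_iSup S.upper (C.prHom ∘ₗ A.brHom x)
      (C.prHom ∘ₗ A.brHom (C.pr x) ∘ₗ C.prHom) (fun j y hy =>
        LinearMap.eq_of_mem_iSup S.upper (C.prHom ∘ₗ A.brHom.flip y)
          (C.prHom ∘ₗ A.brHom.flip (C.pr y) ∘ₗ C.prHom)
          (fun i x hx => hprN i j x hx y hy) hx) hy
  let g : DGLAHom N M :=
    { toFun := fun x => ⟨C.pr (x : ↥(⨆ i, S.upper i)).1, hW _ x.2⟩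
      lin := ⟨fun x y => Subtype.ext (C.pr_lin.map_add _ _),
        fun c x => Subtype.ext (C.pr_lin.map_smul _ _)⟩
      map_grading := fun i x hx => C.pr_mem (S.upper_le i hx)
      map_d := fun x => Subtype.ext ((C.pr_d _).trans (congrArg Subtype.val (hM _)).symm)
      map_br := fun x y => Subtype.ext (hbr' _ x.2 _ y.2) }
  -- cocycles of `N` killed by `pr` are coboundaries
  have hN : ∀ i, ∀ x ∈ N.cocycles i, C.pr (x : ↥(⨆ i, S.upper i)).1 = 0 →
      x ∈ N.coboundaries i := fun i x hx hpr => by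
    have hx1 : (x : ↥(⨆ i, S.upper i)).1 ∈ S.upper i := hx.1
    have hx2 : A.d (x : ↥(⨆ i, S.upper i)).1 = 0 := congrArg Subtype.val hx.2
    obtain ⟨k, hk, hxk⟩ := C.exists_eq_d (S.upper_le i hx1) hx2 hpr
    refine ⟨hx.1, ?_⟩
    rcases le_or_gt 2 i with hi | hi
    · exact ⟨⟨k, Submodule.mem_iSup_of_mem (i - 1) (S.Kc_le_upper (by omega) hk)⟩,
        Subtype.ext hxk.symm⟩
    · have hxH : (x : ↥(⨆ i, S.upper i)).1 ∈ S.H i := by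
        rcases (by omega : i < 1 ∨ i = 1) with h | rfl
        · rwa [GradedSplitting.upper_of_lt h] at hx1
        · rw [GradedSplitting.upper_one] at hx1
          obtain ⟨a, ha, l, hl, hal⟩ := Submodule.mem_sup.1 hx1
          have : l = 0 := S.d_Kc_inj 1 l hl (by
            rw [← hal, A.d_add, S.d_H 1 a ha, zero_add] at hx2
            exact hx2)
          rw [← hal, this, add_zero]
          exact ha
      have : x = 0 := Subtype.ext (by
        rw [← C.pr_H i _ hxH, hpr]
        rfl)
      rw [this]
      exact Submodule.zero_mem _
  have hH : ∀ i, ∀ a ∈ S.H i, ∃ x ∈ N.cocycles i, (x : ↥(⨆ i, S.upper i)).1 = a :=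
    fun i a ha => ⟨⟨a, Submodule.mem_iSup_of_mem i (S.H_le_upper i ha)⟩,
      ⟨S.H_le_upper i ha, Subtype.ext (S.d_H i a ha)⟩, rfl⟩
  have hf : f.IsQuasiIso := fun i => by
    refine ⟨fun x hx hfx => hN i x hx ?_, fun y hy => ?_⟩
    · obtain ⟨-, w, hw⟩ := hfx
      exact (congrArg C.pr hw).symm.trans (C.pr_d w)
    · obtain ⟨a, ha, k, hk, rfl⟩ := S.exists_decomp_of_cocycle i hy.1 hy.2
      obtain ⟨x, hx, hxa⟩ := hH i a ha
      refine ⟨x, hx, A.grading i |>.sub_mem (f.map_grading i x hx.1) hy.1, -k, ?_⟩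
      have : f.toFun x = a := hxa
      rw [this, map_neg, DGLA.dHom_apply]
      abel
  have hg : g.IsQuasiIso := fun i => by
    refine ⟨fun x hx hgx => hN i x hx ?_, fun y hy => ?_⟩
    · obtain ⟨-, w, hw⟩ := hgx
      exact (congrArg Subtype.val hw).symm.trans (congrArg Subtype.val (hM w))
    · obtain ⟨x, hx, hxy⟩ := hH i _ hy.1
      refine ⟨x, hx, ?_⟩
      have : g.toFun x = y := Subtype.ext
        ((congrArg C.pr hxy).trans (C.pr_H i _ hy.1))
      rw [this, sub_self]
      exact Submodule.zero_mem _
  exact ⟨M, hM, (ZigzagQIso.of ⟨f, hf⟩).symm.trans (ZigzagQIso.of ⟨g, hg⟩)⟩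

end Formality

/-! ### Vanishing of the transferred brackets -/

section Transfer

variable {A : DGLA K} {S : GradedSplitting A}

/-- What is needed of the `m`-th Taylor coefficient on tuples of elements of `H⁰ ∪ H¹`: beyond
the first it takes values in `K¹`, and it vanishes if some argument lies in `H⁰`. -/
def TaylorVanishing (S : GradedSplitting A) (m : ℕ) (ιm : (Fin m → A.carrier) → A.carrier) :
    Prop :=
  ∀ v : Fin m → A.carrier, (∀ i, v i ∈ S.H 0 ∨ v i ∈ S.H 1) →
    ιm v ∈ S.Kc 1 ∧ ((∃ i, v i ∈ S.H 0) → ιm v = 0)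

/-- The elements `[ι_k, ι_l]` with some argument in `H⁰` lie in `K¹`, or in `H` if
`k = l = 1`. -/
lemma br_taylor_mem
    (h3H : ∀ i : ℤ, ∀ g ∈ S.H 0, ∀ x ∈ S.H i, A.br g x ∈ S.H i)
    (h3K : ∀ i : ℤ, ∀ g ∈ S.H 0, ∀ x ∈ S.Kc i, A.br g x ∈ S.Kc i)
    {ι : (p : ℕ) → (Fin p → A.carrier) → A.carrier}
    (hι : ∀ v : Fin 1 → A.carrier, ι 1 v = v 0) {k l : ℕ} (hk : 1 ≤ k) (hl : 1 ≤ l)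
    (ihk : 2 ≤ k → TaylorVanishing S k (ι k)) (ihl : 2 ≤ l → TaylorVanishing S l (ι l))
    (a : Fin k → A.carrier) (b : Fin l → A.carrier)
    (ha : ∀ i, a i ∈ S.H 0 ∨ a i ∈ S.H 1) (hb : ∀ i, b i ∈ S.H 0 ∨ b i ∈ S.H 1)
    (ha0 : ∃ i, a i ∈ S.H 0) :
    (A.br (ι k a) (ι l b) ∈ S.Kc 1 ∧ A.br (ι l b) (ι k a) ∈ S.Kc 1) ∨
      (k + l = 2 ∧ ∃ i, A.br (ι k a) (ι l b) ∈ S.H i ∧ A.br (ι l b) (ι k a) ∈ S.H i) := by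
  obtain ⟨i, hi⟩ := ha0
  rcases eq_or_lt_of_le hk with rfl | hk
  · have hg : ι 1 a ∈ S.H 0 := by
      rw [hι]
      convert hi
    rcases eq_or_lt_of_le hl with rfl | hl
    · right
      obtain ⟨j, hj⟩ : ∃ j, ι 1 b ∈ S.H j := by
        rw [hι]
        rcases hb 0 with h | h
        exacts [⟨0, h⟩, ⟨1, h⟩]
      refine ⟨rfl, j, h3H j _ hg _ hj, ?_⟩
      rw [A.br_comm_of_degree_zero (S.H_le _ hg) (S.H_le _ hj)]
      exact Submodule.neg_mem _ (h3H j _ hg _ hj)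
    · left
      have hx := (ihl hl b hb).1
      refine ⟨h3K 1 _ hg _ hx, ?_⟩
      rw [A.br_comm_of_degree_zero (S.H_le _ hg) (S.Kc_le _ hx)]
      exact Submodule.neg_mem _ (h3K 1 _ hg _ hx)
  · left
    rw [(ihk hk a ha).2 ⟨i, hi⟩, A.br_zero, A.zero_br]
    exact ⟨Submodule.zero_mem _, Submodule.zero_mem _⟩

/-- Taylor coefficients on tuples of elements of `H¹` have degree `1`. -/
lemma taylor_mem_grading_one
    {ι : (p : ℕ) → (Fin p → A.carrier) → A.carrier}
    (hι : ∀ v : Fin 1 → A.carrier, ι 1 v = v 0) {k : ℕ} (hk : 1 ≤ k)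
    (ihk : 2 ≤ k → TaylorVanishing S k (ι k)) (a : Fin k → A.carrier)
    (ha : ∀ i, a i ∈ S.H 1) : ι k a ∈ A.grading 1 := by
  rcases eq_or_lt_of_le hk with rfl | hk
  · rw [hι]
    exact S.H_le 1 (ha 0)
  · exact S.Kc_le 1 (ihk hk a fun i => Or.inr (ha i)).1

lemma finIdx_eq {p m : ℕ} (h : m < p + 2) : finIdx p m = ⟨m, h⟩ :=
  Fin.ext (Nat.mod_eq_of_lt h)

/-- The summands of the transfer formulas on elements of `H⁰ ∪ H¹`. -/
lemma transfer_summand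
    (h3H : ∀ i : ℤ, ∀ g ∈ S.H 0, ∀ x ∈ S.H i, A.br g x ∈ S.H i)
    (h3K : ∀ i : ℤ, ∀ g ∈ S.H 0, ∀ x ∈ S.Kc i, A.br g x ∈ S.Kc i)
    {ι : (p : ℕ) → (Fin p → A.carrier) → A.carrier}
    (hι : ∀ v : Fin 1 → A.carrier, ι 1 v = v 0) (p : ℕ)
    (ih : ∀ m, 2 ≤ m → m < p + 2 → TaylorVanishing S m (ι m))
    (v : Fin (p + 2) → A.carrier) (hv : ∀ i, v i ∈ S.H 0 ∨ v i ∈ S.H 1)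
    {k : ℕ} (hk : k ∈ Finset.Ioo 0 (p + 2)) (σ : Equiv.Perm (Fin (p + 2)))
    {w : A.carrier} (hw : w = A.br (ι k fun i => v (σ (finIdx p (i : ℕ))))
      (ι (p + 2 - k) fun i => v (σ (finIdx p (k + (i : ℕ)))))) :
    ((∃ i, v i ∈ S.H 0) → w ∈ S.Kc 1 ∨ (p = 0 ∧ ∃ i, w ∈ S.H i)) ∧
      ((¬ ∃ i, v i ∈ S.H 0) → w ∈ A.grading 2) := by
  subst hw
  obtain ⟨hk0, hk⟩ := Finset.mem_Ioo.1 hk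
  have ihk : 2 ≤ k → TaylorVanishing S k (ι k) := fun h => ih k h hk
  have ihl : 2 ≤ p + 2 - k → TaylorVanishing S (p + 2 - k) (ι (p + 2 - k)) :=
    fun h => ih _ h (by omega)
  refine ⟨?_, fun h => ?_⟩
  · rintro ⟨i, hi⟩
    obtain ⟨j, rfl⟩ := σ.surjective i
    rcases lt_or_ge (j : ℕ) k with hj | hj
    · rcases br_taylor_mem h3H h3K hι hk0 (by omega) ihk ihl
        (fun i => v (σ (finIdx p (i : ℕ)))) (fun i => v (σ (finIdx p (k + (i : ℕ)))))
        (fun _ => hv _) (fun _ => hv _)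
        ⟨⟨j, hj⟩, by rwa [finIdx_eq j.2]⟩ with h | ⟨h, n, h'⟩
      · exact Or.inl h.1
      · exact Or.inr ⟨by omega, n, h'.1⟩
    · rcases br_taylor_mem h3H h3K hι (by omega) hk0 ihl ihk
        (fun i => v (σ (finIdx p (k + (i : ℕ))))) (fun i => v (σ (finIdx p (i : ℕ))))
        (fun _ => hv _) (fun _ => hv _)
        ⟨⟨j - k, by omega⟩, by
          have : finIdx p (k + (j - k)) = j := by
            rw [Nat.add_sub_cancel' hj, finIdx_eq j.2]
          simpa only [this] using hi⟩ with h | ⟨h, n, h'⟩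
      · exact Or.inl h.2
      · exact Or.inr ⟨by omega, n, h'.2⟩
  · have hv1 : ∀ i, v i ∈ S.H 1 := fun i => (hv i).resolve_left fun h' => h ⟨i, h'⟩
    exact A.br_mem 1 1 _ (taylor_mem_grading_one hι hk0 ihk _ fun _ => hv1 _) _
      (taylor_mem_grading_one hι (by omega) ihl _ fun _ => hv1 _)

variable {C : ContractionData A S} {ι bh : (p : ℕ) → (Fin p → A.carrier) → A.carrier}

lemma IsTransfer.taylorVanishing (hT : IsTransfer A S C ι bh)
    (h3H : ∀ i : ℤ, ∀ g ∈ S.H 0, ∀ x ∈ S.H i, A.br g x ∈ S.H i)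
    (h3K : ∀ i : ℤ, ∀ g ∈ S.H 0, ∀ x ∈ S.Kc i, A.br g x ∈ S.Kc i) (m : ℕ) (hm : 2 ≤ m) :
    TaylorVanishing S m (ι m) := by
  induction m using Nat.strong_induction_on with
  | _ m ih =>
    obtain ⟨p, rfl⟩ := Nat.exists_eq_add_of_le' hm
    intro v hv
    have hdg : ∀ i, ∃ n, v i ∈ S.H n := fun i => (hv i).elim (fun h => ⟨0, h⟩) fun h => ⟨1, h⟩
    choose dg hdg using hdg
    have key := fun k hk σ => transfer_summand h3H h3K hT.iota_one p
      (fun m h h' => ih m h' h) v hv (k := k) hk σ rfl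
    rw [hT.iota_rec p dg v hdg]
    by_cases h0 : ∃ i, v i ∈ S.H 0
    · suffices h : ∀ x : A.carrier, x = 0 → x ∈ S.Kc 1 ∧ ((∃ i, v i ∈ S.H 0) → x = 0) by
        apply h
        rw [Finset.sum_eq_zero, smul_zero]
        refine fun k hk => Finset.sum_eq_zero fun σ _ => ?_
        rcases (key k hk σ).1 h0 with h | ⟨-, i, h⟩
        · rw [C.h_K 1 _ h, smul_zero]
        · rw [C.h_H i _ h, smul_zero]
      rintro x rfl
      exact ⟨Submodule.zero_mem _, fun _ => rfl⟩
    · refine ⟨Submodule.smul_mem _ _ (Submodule.sum_mem _ fun k hk =>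
        Submodule.sum_mem _ fun σ _ => Submodule.smul_mem _ _ ?_), fun h => absurd h h0⟩
      exact C.h_mem ((key k hk σ).2 h0)

/-- If `H` is concentrated in degrees `0` and `1` and `H⁰` acts on the pieces of the splitting,
then the transferred brackets of arity at least `3` vanish. -/
lemma IsTransfer.bracket_eq_zero (hT : IsTransfer A S C ι bh)
    (h1 : ∀ i : ℤ, i < 0 → S.H i = ⊥) (h4 : ∀ i : ℤ, 2 ≤ i → S.H i = ⊥)
    (h3H : ∀ i : ℤ, ∀ g ∈ S.H 0, ∀ x ∈ S.H i, A.br g x ∈ S.H i)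
    (h3K : ∀ i : ℤ, ∀ g ∈ S.H 0, ∀ x ∈ S.Kc i, A.br g x ∈ S.Kc i) {p : ℕ} (hp : 3 ≤ p)
    (dg : Fin p → ℤ) (v : Fin p → A.carrier) (hv : ∀ i, v i ∈ S.H (dg i)) : bh p v = 0 := by
  obtain ⟨p, rfl⟩ := Nat.exists_eq_add_of_le' (show 2 ≤ p by omega)
  have hv' : ∀ i, v i ∈ S.H 0 ∨ v i ∈ S.H 1 := fun i => by
    have h := hv i
    rcases (by omega : dg i < 0 ∨ dg i = 0 ∨ dg i = 1 ∨ 2 ≤ dg i) with h' | h' | h' | h'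
    · rw [h1 _ h', Submodule.mem_bot] at h
      exact Or.inl (h ▸ Submodule.zero_mem _)
    · exact Or.inl (h' ▸ h)
    · exact Or.inr (h' ▸ h)
    · rw [h4 _ h', Submodule.mem_bot] at h
      exact Or.inl (h ▸ Submodule.zero_mem _)
  rw [hT.bracket_rec p dg v hv, Finset.sum_eq_zero, smul_zero]
  refine fun k hk => Finset.sum_eq_zero fun σ _ => ?_
  have key := transfer_summand h3H h3K hT.iota_one p
    (fun m h _ => hT.taylorVanishing h3H h3K m h) v hv' hk σ rfl
  by_cases h0 : ∃ i, v i ∈ S.H 0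
  · rcases key.1 h0 with h | ⟨h, -⟩
    · rw [C.pr_K 1 _ h, smul_zero]
    · omega
  · have h := C.pr_mem (key.2 h0)
    rw [h4 2 le_rfl, Submodule.mem_bot] at h
    rw [h, smul_zero]

end Transfer

/-- **Formality in degree 1.**  For a quasi-cyclic DGLA of degree `1` with a
splitting satisfying the standing conditions, all transferred higher brackets
`{⋯}_p`, `p ≥ 3`, vanish on (homogeneous tuples of) `H`; consequently the transferred
minimal `L∞` model of `L` is the graded Lie algebra `H ≅ H^*(L)` and `L` is
formal. -/
theorem formality_of_quasiCyclic_degree_one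
    {K : Type} [Field K] [CharZero K]
    (A : QCyclicDGLA K 1) (S : GradedSplitting A.toDGLA)
    (h1 : ∀ i : ℤ, i < 0 → S.H i = ⊥)
    (h2 : ∀ x ∈ S.H 0, ∀ y ∈ S.H 0, A.br x y ∈ S.H 0)
    (h3H : ∀ i : ℤ, ∀ g ∈ S.H 0, ∀ x ∈ S.H i, A.br g x ∈ S.H i)
    (h3K : ∀ i : ℤ, ∀ g ∈ S.H 0, ∀ x ∈ S.Kc i, A.br g x ∈ S.Kc i)
    (hperp : ∀ i j : ℤ, ∀ x ∈ S.H i, ∀ y ∈ S.Kc j, A.form x y = 0)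
    (C : ContractionData A.toDGLA S)
    (ι bh : (p : ℕ) → (Fin p → A.carrier) → A.carrier)
    (hT : IsTransfer A.toDGLA S C ι bh) :
    -- all higher transferred brackets vanish on homogeneous tuples of `H`
    (∀ (p : ℕ), 3 ≤ p → ∀ (dg : Fin p → ℤ) (v : Fin p → A.carrier),
      (∀ i, v i ∈ S.H (dg i)) → bh p v = 0) ∧
    -- and `L` is formal
    A.toDGLA.IsFormal := by
  have h4 := S.H_eq_bot_of_two_le A C h1
  exact ⟨fun p hp dg v hv => hT.bracket_eq_zero h1 h4 h3H h3K hp dg v hv,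
    C.isFormal h1 h4 h3H h3K⟩
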